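/- (Theorem 4, from [MWZ16] and [HZ18]) Let w : ℝⁿ → ℝ be infinity harmonic in all of ℝⁿ with Lip(w, ℝⁿ) < +∞. Then there exists a ∈ ℝⁿ with |a| = Lip(w, ℝⁿ) such that w(x) = a·x + o(|x|) as x → ∞, i.e. (w(x) − a·x)/|x| → 0 as |x| → ∞. -/

import Mathlib

open Metric Set Filter Bornology Topology
open scoped RealInnerProductSpace

noncomputable section

/-- Euclidean space ℝⁿ. -/
abbrev Euc (n : ℕ) := EuclideanSpace ℝ (Fin n)

/-- Comparison with cones from above (infinity subharmonic). -/
def CmpAbove {n : ℕ} (Ω : Set (Euc n)) (u : Euc n → ℝ) : Prop :=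
  ∀ V : Set (Euc n), IsOpen V → IsBounded V → closure V ⊆ Ω →
    ∀ (x₀ : Euc n) (a b : ℝ),
      (∀ x ∈ frontier (V \ {x₀}), u x ≤ a * ‖x - x₀‖ + b) →
      ∀ x ∈ V, u x ≤ a * ‖x - x₀‖ + b

/-- Comparison with cones from below (infinity superharmonic). -/
def CmpBelow {n : ℕ} (Ω : Set (Euc n)) (u : Euc n → ℝ) : Prop :=
  ∀ V : Set (Euc n), IsOpen V → IsBounded V → closure V ⊆ Ω →
    ∀ (x₀ : Euc n) (a b : ℝ),
      (∀ x ∈ frontier (V \ {x₀}), a * ‖x - x₀‖ + b ≤ u x) →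
      ∀ x ∈ V, a * ‖x - x₀‖ + b ≤ u x

/-- Infinity harmonic = comparison with cones from both sides. -/
def InfHarmonic {n : ℕ} (Ω : Set (Euc n)) (u : Euc n → ℝ) : Prop :=
  CmpAbove Ω u ∧ CmpBelow Ω u

/-- m⁺ = max of u on ∂Ω. -/
def mP {n : ℕ} (Ω : Set (Euc n)) (u : Euc n → ℝ) : ℝ := sSup (u '' frontier Ω)

/-- m⁻ = min of u on ∂Ω. -/
def mM {n : ℕ} (Ω : Set (Euc n)) (u : Euc n → ℝ) : ℝ := sInf (u '' frontier Ω)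

/-- S⁺_r := (max(max_{∂B_r} u, m⁺) − m⁺)/r. -/
def SP {n : ℕ} (Ω : Set (Euc n)) (u : Euc n → ℝ) (r : ℝ) : ℝ :=
  (max (sSup (u '' sphere (0 : Euc n) r)) (mP Ω u) - mP Ω u) / r

/-- S⁻_r := (m⁻ − min(min_{∂B_r} u, m⁻))/r. -/
def SM {n : ℕ} (Ω : Set (Euc n)) (u : Euc n → ℝ) (r : ℝ) : ℝ :=
  (mM Ω u - min (sInf (u '' sphere (0 : Euc n) r)) (mM Ω u)) / r

/-- Lip(u, S) := sup_{x≠y ∈ S} |u(x) − u(y)|/|x − y|. -/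
def lipOn {n : ℕ} (u : Euc n → ℝ) (S : Set (Euc n)) : ℝ :=
  sSup ((fun p : Euc n × Euc n => |u p.1 - u p.2| / ‖p.1 - p.2‖) ''
    {p : Euc n × Euc n | p.1 ∈ S ∧ p.2 ∈ S ∧ p.1 ≠ p.2})

section Core
variable {E : Type*} [NormedAddCommGroup E] [InnerProductSpace ℝ E]

/-- The cone estimate on balls satisfied by infinity subharmonic functions. -/
def BallConeBound (u : E → ℝ) : Prop :=
  ∀ (x : E) (r : ℝ), 0 < r → ∃ z, ‖z - x‖ ≤ r ∧ u x ≤ u z ∧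
    ∀ y, ‖y - x‖ ≤ r → u y - u x ≤ (u z - u x) * (‖y - x‖ / r)

/-- Subharmonicity for the finite difference infinity Laplacian with step `ε`. -/
def DiscreteSub (ε : ℝ) (U : E → ℝ) : Prop :=
  ∀ x, ∃ x', ‖x' - x‖ ≤ ε ∧ ∀ z, ‖z - x‖ ≤ ε → 2 * U x ≤ U x' + U z

theorem exists_discreteSub [ProperSpace E] {u : E → ℝ} (hu : BallConeBound u)
    (hL : ∀ x y, u x - u y ≤ ‖x - y‖) {ε : ℝ} (hε : 0 < ε) :
    ∃ U : E → ℝ, Continuous U ∧ (∀ x, u x ≤ U x) ∧ (∀ x, U x ≤ u x + ε) ∧ DiscreteSub ε U := by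
  have hL1 : LipschitzWith 1 u := LipschitzWith.of_le_add fun x y => by
    rw [dist_eq_norm]; linarith [hL x y]
  have hex : ∀ x, ∃ m, ‖m - x‖ ≤ ε ∧ ∀ z, ‖z - x‖ ≤ ε → u z ≤ u m := by
    intro x
    obtain ⟨m, hm, hmax⟩ := (isCompact_closedBall x ε).exists_isMaxOn
      ⟨x, mem_closedBall_self hε.le⟩ hL1.continuous.continuousOn
    refine ⟨m, by simpa [dist_eq_norm] using hm, fun z hz => hmax ?_⟩
    simpa [dist_eq_norm] using hz
  choose m hm1 hm2 using hex
  refine ⟨fun x => u (m x), ?_, ?_, ?_, ?_⟩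
  · refine LipschitzWith.continuous (K := 1) (LipschitzWith.of_le_add fun x y => ?_)
    rw [dist_eq_norm]
    have h1 := hm2 y (m x + (y - x)) (by
      rw [show m x + (y - x) - y = m x - x by abel]; exact hm1 x)
    have h2 := hL (m x) (m x + (y - x))
    rw [show m x - (m x + (y - x)) = x - y by abel] at h2
    linarith
  · exact fun x => hm2 x x (by simpa using hε.le)
  · intro x
    linarith [hL (m x) x, hm1 x]
  · intro x
    obtain ⟨z, hz, hxz, hcone⟩ := hu x (2 * ε) (by linarith)
    -- the midpoint of `x` and `z` sees `z`
    refine ⟨x + (1 / 2 : ℝ) • (z - x), ?_, ?_⟩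
    · rw [add_sub_cancel_left, norm_smul]; norm_num; linarith
    · intro t ht
      have h1 := hm2 (x + (1 / 2 : ℝ) • (z - x)) z (by
        rw [show z - (x + (1 / 2 : ℝ) • (z - x)) = (1 / 2 : ℝ) • (z - x) by module, norm_smul]
        norm_num; linarith)
      have h2 := hm2 t x (by rwa [norm_sub_rev])
      have h3 := hcone (m x) (by linarith [hm1 x])
      have h4 : ‖m x - x‖ / (2 * ε) ≤ 1 / 2 := by
        rw [div_le_iff₀ (by linarith)]; linarith [hm1 x]
      have h5 := mul_le_mul_of_nonneg_left h4 (sub_nonneg.2 hxz)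
      simp only
      linarith

theorem norm_sub_normalize_sq_le {p d : E} {c : ℝ} (hp : p ≠ 0) (hd : ‖d‖ ≤ 1)
    (h : ‖p‖ - c ≤ ⟪p, d⟫) : ‖d - ‖p‖⁻¹ • p‖ ^ 2 ≤ 2 * c / ‖p‖ := by
  have hp' : 0 < ‖p‖ := norm_pos_iff.2 hp
  rw [norm_sub_sq_real, inner_smul_right, norm_smul, real_inner_comm]
  have h1 : ‖d‖ ^ 2 ≤ 1 := by nlinarith [norm_nonneg d]
  have h2 : ‖‖p‖⁻¹‖ * ‖p‖ = 1 := by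
    rw [norm_inv, norm_norm]; field_simp
  rw [h2]
  have h3 : 1 - c / ‖p‖ ≤ ‖p‖⁻¹ * ⟪p, d⟫ := by
    rw [← sub_nonneg]
    have : ‖p‖⁻¹ * ⟪p, d⟫ - (1 - c / ‖p‖) = (⟪p, d⟫ - (‖p‖ - c)) / ‖p‖ := by
      field_simp
    rw [this]; apply div_nonneg _ hp'.le; linarith
  have : 2 * c / ‖p‖ = 2 * (c / ‖p‖) := by ring
  rw [this]; linarith

theorem norm_normalize_sub_le {p q : E} (hp : p ≠ 0) (hq : q ≠ 0) :
    ‖‖p‖⁻¹ • p - ‖q‖⁻¹ • q‖ ≤ 2 * ‖p - q‖ / ‖q‖ := by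
  have hp' : 0 < ‖p‖ := norm_pos_iff.2 hp
  have hq' : 0 < ‖q‖ := norm_pos_iff.2 hq
  have h1 : ‖p‖⁻¹ • p - ‖q‖⁻¹ • q
      = ‖q‖⁻¹ • (p - q) + ((‖q‖ - ‖p‖) / ‖q‖) • (‖p‖⁻¹ • p) := by
    have : ((‖q‖ - ‖p‖) / ‖q‖) * ‖p‖⁻¹ = ‖p‖⁻¹ - ‖q‖⁻¹ := by field_simp
    rw [smul_smul, this]; module
  have h2 : ‖‖p‖⁻¹ • p‖ = 1 := by
    rw [norm_smul, norm_inv, norm_norm]; field_simp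
  have h3 : |‖q‖ - ‖p‖| ≤ ‖p - q‖ := by
    rw [norm_sub_rev]; exact abs_norm_sub_norm_le q p
  calc _ ≤ ‖‖q‖⁻¹ • (p - q)‖ + ‖((‖q‖ - ‖p‖) / ‖q‖) • (‖p‖⁻¹ • p)‖ := by
        rw [h1]; exact norm_add_le _ _
    _ = ‖p - q‖ / ‖q‖ + |‖q‖ - ‖p‖| / ‖q‖ := by
        rw [norm_smul, norm_smul, h2, norm_inv, norm_norm, Real.norm_eq_abs, abs_div,
          abs_of_pos hq']
        ring
    _ ≤ ‖p - q‖ / ‖q‖ + ‖p - q‖ / ‖q‖ := by gcongr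
    _ = _ := by ring

/-- A discrete subharmonic function touched from above at `x` by a paraboloid with gradient `p`
has its steepest discrete ascent nearly in the direction of `p`. -/
theorem ascent_of_touching {U : E → ℝ} {ε c : ℝ} (hε : 0 < ε) {x x' p : E}
    (hx' : ‖x' - x‖ ≤ ε) (hsub : ∀ z, ‖z - x‖ ≤ ε → 2 * U x ≤ U x' + U z)
    (htouch : ∀ z, ‖z - x‖ ≤ ε → U z - U x ≤ ⟪p, z - x⟫ + c * ‖z - x‖ ^ 2) (hp : p ≠ 0)
    (hc : 0 ≤ c) :
    ε * (‖p‖ - c * ε) ≤ U x' - U x ∧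
      ‖ε⁻¹ • (x' - x) - ‖p‖⁻¹ • p‖ ^ 2 ≤ 2 * (2 * c * ε) / ‖p‖ := by
  have hp' : 0 < ‖p‖ := norm_pos_iff.2 hp
  set z := x - (ε * ‖p‖⁻¹) • p with hz
  have hzx : z - x = -((ε * ‖p‖⁻¹) • p) := by rw [hz]; abel
  have hzn : ‖z - x‖ = ε := by
    rw [hzx, norm_neg, norm_smul, norm_mul, norm_inv, norm_norm, Real.norm_eq_abs, abs_of_pos hε]
    field_simp
  have h1 := hsub z hzn.le
  have h2 := htouch z hzn.le
  have h3 : ⟪p, z - x⟫ = -(ε * ‖p‖) := by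
    rw [hzx, inner_neg_right, inner_smul_right, real_inner_self_eq_norm_sq]; field_simp
  rw [h3, hzn] at h2
  have h4 : ε * (‖p‖ - c * ε) ≤ U x' - U x := by nlinarith
  refine ⟨h4, norm_sub_normalize_sq_le hp ?_ ?_⟩
  · rw [norm_smul, norm_inv, Real.norm_eq_abs, abs_of_pos hε, inv_mul_le_iff₀ hε]; linarith
  · have h5 := htouch x' hx'
    have h6 : c * ‖x' - x‖ ^ 2 ≤ c * ε ^ 2 := by gcongr
    rw [inner_smul_right, ← div_eq_inv_mul, le_div_iff₀ hε]
    nlinarith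

theorem slope_estimates {θ k l β : ℝ} (hθ : 0 < θ) (hθ2 : θ ≤ 2) (hk : k = θ ^ 2 / 128)
    (hl : l = θ ^ 3 / 10 ^ 6) {e g P x : E} (he : ‖e‖ = 1) (hP : P = g + k • e)
    (hβ : β ≤ 1 - θ) (h : 1 / 2 - k * β - 14 * l ≤ ‖g‖ - ‖P‖ ^ 2 / 2 - ‖x‖ ^ 2) :
    ‖x‖ ≤ 1 / 2 ∧ |‖P‖ - 1| ≤ θ / 4 ∧ ⟪P, e⟫ ≤ 1 - 3 * θ / 4 := by
  have hk0 : 0 < k := by rw [hk]; positivity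
  have hl0 : 0 < l := by rw [hl]; positivity
  have hθs : θ ^ 2 ≤ 2 * θ := by nlinarith
  have hlk : l = k * (128 * θ / 10 ^ 6) := by rw [hl, hk]; ring
  have hlk' : 14 * l ≤ k := by rw [hlk]; nlinarith
  have hg : g = P - k • e := by rw [hP]; abel
  have hg1 : ‖g‖ ≤ ‖P‖ + k := by
    rw [hg]; refine (norm_sub_le _ _).trans ?_
    rw [norm_smul, he, Real.norm_eq_abs, abs_of_pos hk0, mul_one]
  have hg2 : ‖g‖ ^ 2 = ‖P‖ ^ 2 - 2 * k * ⟪P, e⟫ + k ^ 2 := by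
    rw [hg, norm_sub_sq_real, inner_smul_right, norm_smul, he, Real.norm_eq_abs, abs_of_pos hk0]
    ring
  have hkβ : k * β ≤ k := by nlinarith
  have hsq : (‖P‖ - 1) ^ 2 / 2 + ‖x‖ ^ 2 ≤ θ ^ 2 / 32 := by
    have : (‖P‖ - 1) ^ 2 / 2 + ‖x‖ ^ 2 ≤ 2 * k + 14 * l := by nlinarith
    linarith
  refine ⟨?_, ?_, ?_⟩
  · refine abs_le_of_sq_le_sq' ?_ (by norm_num) |>.2
    nlinarith [sq_nonneg (‖P‖ - 1)]
  · refine abs_le_of_sq_le_sq ?_ (by linarith)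
    nlinarith [sq_nonneg ‖x‖]
  · have h1 : k * ⟪P, e⟫ ≤ k * (β + k / 2 + 14 * (128 * θ / 10 ^ 6)) := by
      nlinarith [sq_nonneg (‖g‖ - 1), sq_nonneg ‖x‖]
    have h2 := le_of_mul_le_mul_left h1 hk0
    linarith

/-- The auxiliary function for doubling of variables. -/
def doubling (U V : E → ℝ) (e : E) (k l δ : ℝ) (x y : E) : ℝ :=
  U x - V y - ‖x - y + (k * δ) • e‖ ^ 2 / (2 * δ) + δ / l * (U x - ⟪e, x⟫ + l) ^ 2
    - δ * ‖x‖ ^ 2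

theorem touching_left {U V : E → ℝ} {e x y z P : E} {k l δ σ s : ℝ} (hδ : 0 < δ) (hδ2 : δ ≤ 1 / 2)
    (hl : 0 < l) (hs : s = U x - ⟪e, x⟫ + l) (hs0 : 0 ≤ s) (hσ : σ = 2 * δ / l * s)
    (hP : x - y + (k * δ) • e = δ • P)
    (h : doubling U V e k l δ z y ≤ doubling U V e k l δ x y) :
    U z - U x ≤ ⟪(1 + σ)⁻¹ • (P + σ • e + (2 * δ) • x), z - x⟫ + 1 / δ * ‖z - x‖ ^ 2 := by
  obtain ⟨w, rfl⟩ : ∃ w, z = x + w := ⟨z - x, by abel⟩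
  have hσ0 : 0 ≤ σ := by rw [hσ]; positivity
  unfold doubling at h
  rw [show x + w - y + (k * δ) • e = δ • P + w by rw [← hP]; abel, hP, norm_add_sq_real,
    norm_add_sq_real, inner_smul_left, inner_add_right] at h
  rw [add_sub_cancel_left, inner_smul_left, inner_add_left, inner_add_left, inner_smul_left,
    inner_smul_left]
  simp only [conj_trivial] at h ⊢
  set Δ := U (x + w) - U x with hΔ
  have hU : U (x + w) = Δ + U x := by rw [hΔ]; ring
  have hUx : U x = s + ⟪e, x⟫ - l := by rw [hs]; ring
  rw [hU] at h
  have e1 : (Δ + U x - (⟪e, x⟫ + ⟪e, w⟫) + l) = s + (Δ - ⟪e, w⟫) := by rw [hUx]; ring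
  have e2 : U x - ⟪e, x⟫ + l = s := hs.symm
  rw [e1, e2] at h
  have e3 : (‖δ • P‖ ^ 2 + 2 * (δ * ⟪P, w⟫) + ‖w‖ ^ 2) / (2 * δ)
      = ‖δ • P‖ ^ 2 / (2 * δ) + ⟪P, w⟫ + ‖w‖ ^ 2 / (2 * δ) := by field_simp
  have e4 : δ / l * (s + (Δ - ⟪e, w⟫)) ^ 2
      = δ / l * s ^ 2 + σ * (Δ - ⟪e, w⟫) + δ / l * (Δ - ⟪e, w⟫) ^ 2 := by rw [hσ]; ring
  rw [e3, e4] at h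
  have h1 : 0 ≤ δ / l * (Δ - ⟪e, w⟫) ^ 2 := by positivity
  have h2 : ‖w‖ ^ 2 / (2 * δ) + δ * ‖w‖ ^ 2 ≤ 1 / δ * ‖w‖ ^ 2 := by
    have : 1 / (2 * δ) + δ ≤ 1 / δ := by
      rw [div_add' _ _ _ (by positivity), div_le_div_iff₀ (by positivity) hδ]
      have : δ * (2 * δ) ≤ 1 := by nlinarith
      nlinarith
    calc _ = (1 / (2 * δ) + δ) * ‖w‖ ^ 2 := by ring
      _ ≤ _ := by gcongr
  have h3 : (1 + σ) * Δ ≤ ⟪P, w⟫ + σ * ⟪e, w⟫ + 2 * δ * ⟪x, w⟫ + 1 / δ * ‖w‖ ^ 2 := by linarith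
  have h4 : Δ ≤ (1 + σ)⁻¹ * (⟪P, w⟫ + σ * ⟪e, w⟫ + 2 * δ * ⟪x, w⟫ + 1 / δ * ‖w‖ ^ 2) := by
    rw [← div_eq_inv_mul, le_div_iff₀ (by linarith)]; linarith
  have h5 : (1 + σ)⁻¹ * (1 / δ * ‖w‖ ^ 2) ≤ 1 / δ * ‖w‖ ^ 2 :=
    mul_le_of_le_one_left (by positivity) (inv_le_one_of_one_le₀ (by linarith))
  linarith

theorem touching_right {U V : E → ℝ} {e x y z P : E} {k l δ : ℝ} (hδ : 0 < δ)
    (hP : x - y + (k * δ) • e = δ • P)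
    (h : doubling U V e k l δ x z ≤ doubling U V e k l δ x y) :
    (-V z) - (-V y) ≤ ⟪-P, z - y⟫ + 1 / (2 * δ) * ‖z - y‖ ^ 2 := by
  obtain ⟨w, rfl⟩ : ∃ w, z = y + w := ⟨z - y, by abel⟩
  unfold doubling at h
  rw [show x - (y + w) + (k * δ) • e = δ • P - w by rw [← hP]; abel, hP, norm_sub_sq_real,
    inner_smul_left] at h
  rw [add_sub_cancel_left, inner_neg_left]
  simp only [conj_trivial] at h
  have e3 : (‖δ • P‖ ^ 2 - 2 * (δ * ⟪P, w⟫) + ‖w‖ ^ 2) / (2 * δ)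
      = ‖δ • P‖ ^ 2 / (2 * δ) - ⟪P, w⟫ + 1 / (2 * δ) * ‖w‖ ^ 2 := by field_simp
  rw [e3] at h
  linarith

theorem norm_sub_gradient_le {e x P : E} {σ δ : ℝ} (hδ : 0 ≤ δ) (hσ : 0 ≤ σ) (hσδ : σ ≤ 6 * δ)
    (he : ‖e‖ = 1) (hx : ‖x‖ ≤ 1 / 2) (hP : ‖P‖ ≤ 3 / 2) :
    ‖(1 + σ)⁻¹ • (P + σ • e + (2 * δ) • x) - P‖ ≤ 16 * δ := by
  have h1 : (1 + σ)⁻¹ • (P + σ • e + (2 * δ) • x) - P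
      = (1 + σ)⁻¹ • (σ • (e - P) + (2 * δ) • x) := by
    have h0 : P = (1 + σ)⁻¹ • ((1 + σ) • P) := by
      rw [smul_smul, inv_mul_cancel₀ (by linarith), one_smul]
    nth_rewrite 2 [h0]
    rw [← smul_sub]; congr 1; module
  have h2 : ‖e - P‖ ≤ 5 / 2 := (norm_sub_le _ _).trans (by linarith)
  rw [h1, norm_smul, norm_inv, Real.norm_eq_abs, abs_of_pos (by linarith)]
  calc (1 + σ)⁻¹ * ‖σ • (e - P) + (2 * δ) • x‖
      ≤ 1 * (‖σ • (e - P)‖ + ‖(2 * δ) • x‖) := by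
        gcongr
        · exact inv_le_one_of_one_le₀ (by linarith)
        · exact norm_add_le _ _
    _ = σ * ‖e - P‖ + 2 * δ * ‖x‖ := by
        rw [norm_smul, norm_smul, Real.norm_eq_abs, Real.norm_eq_abs, abs_of_nonneg hσ,
          abs_of_nonneg (by linarith)]; ring
    _ ≤ (6 * δ) * (5 / 2) + 2 * δ * (1 / 2) := by gcongr
    _ = 16 * δ := by ring

theorem doubling_second_difference {U V : E → ℝ} {e x y a c P : E} {k l δ s t : ℝ} (hδ : 0 < δ)
    (hl : 0 < l) (hP : x - y + (k * δ) • e = δ • P)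
    (hs : s = U x - ⟪e, x⟫ + l) (hs0 : 0 ≤ s) (ht : t = U (x + a) - U x - ⟪e, a⟫)
    (hU : 2 * U x ≤ U (x + a) + U (x - a)) (hV : V (y - c) + V (y + c) ≤ 2 * V y) :
    δ / l * t ^ 2 - ‖a + c‖ ^ 2 / δ - 2 * δ * ‖a‖ ^ 2 ≤
      doubling U V e k l δ (x + a) (y - c) + doubling U V e k l δ (x - a) (y + c)
        - 2 * doubling U V e k l δ x y := by
  unfold doubling
  rw [show x + a - (y - c) + (k * δ) • e = δ • P + (a + c) by rw [← hP]; abel,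
    show x - a - (y + c) + (k * δ) • e = δ • P - (a + c) by rw [← hP]; abel, hP,
    norm_add_sq_real (δ • P), norm_sub_sq_real (δ • P), norm_add_sq_real x, norm_sub_sq_real x,
    inner_add_right e, inner_sub_right e]
  set q := U (x - a) - U x + ⟪e, a⟫ with hq
  have e1 : U (x + a) - (⟪e, x⟫ + ⟪e, a⟫) + l = s + t := by rw [hs, ht]; ring
  have e2 : U (x - a) - (⟪e, x⟫ - ⟪e, a⟫) + l = s + q := by rw [hs, hq]; ring
  rw [e1, e2, ← hs]
  have h1 : 0 ≤ t + q := by rw [ht, hq]; linarith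
  have h2 : δ / l * t ^ 2 ≤ δ / l * ((s + t) ^ 2 + (s + q) ^ 2 - 2 * s ^ 2) := by
    gcongr; nlinarith [mul_nonneg hs0 h1, sq_nonneg q]
  have e3 : (‖δ • P‖ ^ 2 + 2 * ⟪δ • P, a + c⟫ + ‖a + c‖ ^ 2) / (2 * δ) +
      (‖δ • P‖ ^ 2 - 2 * ⟪δ • P, a + c⟫ + ‖a + c‖ ^ 2) / (2 * δ)
      - 2 * (‖δ • P‖ ^ 2 / (2 * δ)) = ‖a + c‖ ^ 2 / δ := by field_simp; ring
  linarith

theorem not_interior_max {U V : E → ℝ} {e x y P : E} {k l δ θ : ℝ} (hθ : 0 < θ) (hθ2 : θ ≤ 2)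
    (hl : l = θ ^ 3 / 10 ^ 6) (hδ : 0 < δ) (hδl : δ ≤ l) (he : ‖e‖ = 1)
    (hU : DiscreteSub (δ ^ 3) U) (hV : DiscreteSub (δ ^ 3) (fun x => -V x))
    (hP : x - y + (k * δ) • e = δ • P) (hx : ‖x‖ ≤ 1 / 2) (hy : ‖y‖ ≤ 1)
    (hs0 : 0 ≤ U x - ⟪e, x⟫ + l) (hs1 : U x - ⟪e, x⟫ + l ≤ 3 * l)
    (hP1 : |‖P‖ - 1| ≤ θ / 4) (hPe : ⟪P, e⟫ ≤ 1 - 3 * θ / 4)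
    (hmax : ∀ x' y', ‖x'‖ ≤ 1 → ‖y'‖ ≤ 2 →
      doubling U V e k l δ x' y' ≤ doubling U V e k l δ x y) : False := by
  have hl0 : 0 < l := by rw [hl]; positivity
  have hθs : θ ^ 2 ≤ 2 * θ := by nlinarith
  have hlθ : l ≤ θ ^ 2 / 500000 := by rw [hl]; nlinarith [sq_nonneg θ]
  have hlθ' : l ≤ θ / 250000 := by linarith
  have hδ1 : δ ≤ 1 / 125000 := by linarith
  have hδ2 : δ ^ 2 ≤ δ / 125000 := by nlinarith
  have hε : 0 < δ ^ 3 := by positivity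
  have hε1 : δ ^ 3 ≤ 1 / 2 := by nlinarith
  obtain ⟨hPl, hPu⟩ := abs_le.1 hP1
  have hPl' : 1 / 2 ≤ ‖P‖ := by linarith
  have hPu' : ‖P‖ ≤ 3 / 2 := by linarith
  have hP0 : P ≠ 0 := norm_pos_iff.1 (by linarith)
  obtain ⟨s, hs⟩ : ∃ s, s = U x - ⟪e, x⟫ + l := ⟨_, rfl⟩
  rw [← hs] at hs0 hs1
  obtain ⟨σ, hσ⟩ : ∃ σ, σ = 2 * δ / l * s := ⟨_, rfl⟩
  have hσ0 : 0 ≤ σ := by rw [hσ]; positivity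
  have hσ1 : σ ≤ 6 * δ := by
    calc σ = 2 * δ / l * s := hσ
      _ ≤ 2 * δ / l * (3 * l) := by gcongr
      _ = 6 * δ := by field_simp; ring
  obtain ⟨p, hp⟩ : ∃ p, p = (1 + σ)⁻¹ • (P + σ • e + (2 * δ) • x) := ⟨_, rfl⟩
  have hpP : ‖p - P‖ ≤ 16 * δ := hp ▸ norm_sub_gradient_le hδ.le hσ0 hσ1 he hx hPu'
  have hpn : ‖P‖ - 16 * δ ≤ ‖p‖ := by
    have := norm_sub_norm_le P p
    rw [norm_sub_rev] at this; linarith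
  have hp4 : 1 / 4 ≤ ‖p‖ := by linarith
  have hp0 : p ≠ 0 := norm_pos_iff.1 (by linarith)
  obtain ⟨x', hx', hx's⟩ := hU x
  obtain ⟨y', hy', hy's⟩ := hV y
  have nx : ∀ z, ‖z - x‖ ≤ δ ^ 3 → ‖z‖ ≤ 1 := fun z hz => by
    have := norm_add_le (z - x) x
    rw [sub_add_cancel] at this; linarith
  have ny : ∀ z, ‖z - y‖ ≤ δ ^ 3 → ‖z‖ ≤ 2 := fun z hz => by
    have := norm_add_le (z - y) y
    rw [sub_add_cancel] at this; linarith
  obtain ⟨hup, hdx⟩ := ascent_of_touching (c := 1 / δ) hε hx' hx's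
    (fun z hz => touching_left hδ (by linarith) hl0 hs hs0 hσ hP
      (hmax z y (nx z hz) (by linarith))) (hp ▸ hp0) (by positivity)
  obtain ⟨-, hdy⟩ := ascent_of_touching (c := 1 / (2 * δ)) (p := -P) hε hy' hy's
    (fun z hz => touching_right hδ hP (hmax x z (by linarith) (ny z hz)))
    (neg_ne_zero.2 hP0) (by positivity)
  rw [← hp] at hup hdx
  obtain ⟨a, ha⟩ : ∃ a, a = x' - x := ⟨_, rfl⟩
  obtain ⟨c, hc⟩ : ∃ c, c = y' - y := ⟨_, rfl⟩
  obtain ⟨d, hd⟩ : ∃ d, d = (δ ^ 3)⁻¹ • a := ⟨_, rfl⟩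
  obtain ⟨f, hf⟩ : ∃ f, f = (δ ^ 3)⁻¹ • c := ⟨_, rfl⟩
  rw [← ha, ← hd] at hdx
  rw [← hc, ← hf] at hdy
  rw [← ha] at hx'
  rw [← hc] at hy'
  have ead : a = δ ^ 3 • d := by rw [hd, smul_smul, mul_inv_cancel₀ hε.ne', one_smul]
  have ecf : c = δ ^ 3 • f := by rw [hf, smul_smul, mul_inv_cancel₀ hε.ne', one_smul]
  have hd4 : ‖d - ‖p‖⁻¹ • p‖ ≤ 4 * δ := by
    refine abs_le_of_sq_le_sq' (hdx.trans ?_) (by linarith) |>.2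
    rw [div_le_iff₀ (by linarith), show 2 * (2 * (1 / δ) * δ ^ 3) = 4 * δ ^ 2 by field_simp; ring]
    linarith [mul_le_mul_of_nonneg_left hp4 (sq_nonneg δ)]
  have hf2 : ‖f + ‖P‖⁻¹ • P‖ ≤ 2 * δ := by
    rw [norm_neg, smul_neg, sub_neg_eq_add] at hdy
    refine abs_le_of_sq_le_sq' (hdy.trans ?_) (by linarith) |>.2
    rw [div_le_iff₀ (by linarith),
      show 2 * (2 * (1 / (2 * δ)) * δ ^ 3) = 2 * δ ^ 2 by field_simp]
    linarith [mul_le_mul_of_nonneg_left hPl' (sq_nonneg δ)]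
  have hpp : ‖‖p‖⁻¹ • p - ‖P‖⁻¹ • P‖ ≤ 64 * δ := by
    refine (norm_normalize_sub_le hp0 hP0).trans ?_
    rw [div_le_iff₀ (by linarith)]
    linarith [mul_le_mul_of_nonneg_left hPl' hδ.le]
  have hdP : ‖d - ‖P‖⁻¹ • P‖ ≤ 68 * δ := by
    have := norm_add_le (d - ‖p‖⁻¹ • p) (‖p‖⁻¹ • p - ‖P‖⁻¹ • P)
    rw [sub_add_sub_cancel] at this; linarith
  have hdf : ‖d + f‖ ≤ 70 * δ := by
    have := norm_add_le (d - ‖P‖⁻¹ • P) (f + ‖P‖⁻¹ • P)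
    rw [show d - ‖P‖⁻¹ • P + (f + ‖P‖⁻¹ • P) = d + f by abel] at this; linarith
  have hd1 : ‖d‖ ≤ 1 := by
    rw [hd, norm_smul, norm_inv, Real.norm_eq_abs, abs_of_pos hε, inv_mul_le_iff₀ hε]; linarith
  have hPhat : ⟪e, ‖P‖⁻¹ • P⟫ ≤ 1 - θ / 2 := by
    have h1 : ‖‖P‖⁻¹ • P - P‖ ≤ θ / 4 := by
      have h2 : ‖P‖⁻¹ • P - P = (1 - ‖P‖) • (‖P‖⁻¹ • P) := by
        rw [smul_smul, sub_mul, mul_inv_cancel₀ (by linarith), sub_smul, one_mul, one_smul]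
      rw [h2, norm_smul, norm_smul, norm_inv, norm_norm, inv_mul_cancel₀ (by linarith), mul_one,
        Real.norm_eq_abs, abs_sub_comm]
      exact hP1
    have h3 := real_inner_le_norm e (‖P‖⁻¹ • P - P)
    rw [he, one_mul, inner_sub_right, real_inner_comm P e] at h3
    linarith
  have hde : ⟪e, d⟫ ≤ 1 - θ / 2 + 68 * δ := by
    have h3 := real_inner_le_norm e (d - ‖P‖⁻¹ • P)
    rw [he, one_mul, inner_sub_right] at h3
    linarith
  obtain ⟨t, ht⟩ : ∃ t, t = U (x + a) - U x - ⟪e, a⟫ := ⟨_, rfl⟩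
  have hxa : x + a = x' := by rw [ha]; abel
  have hyc : y + c = y' := by rw [hc]; abel
  have ht1 : δ ^ 3 * (θ / 8) ≤ t := by
    have h1 : δ ^ 3 * (θ / 8) ≤ δ ^ 3 * ((‖p‖ - 1 / δ * δ ^ 3) - ⟪e, d⟫) := by
      rw [show 1 / δ * δ ^ 3 = δ ^ 2 by field_simp]
      gcongr; linarith
    rw [ht, hxa, ead, inner_smul_right]
    linarith
  have hsd := doubling_second_difference (a := a) (c := c) (U := U) (V := V) hδ hl0 hP hs hs0 ht
    (by rw [hxa]; refine hx's _ ?_; rw [sub_sub_cancel_left, norm_neg]; exact hx')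
    (by
      have := hy's (y - c) (by rw [sub_sub_cancel_left, norm_neg]; exact hy')
      rw [hyc]; linarith)
  have hm1 := hmax (x + a) (y - c) (nx _ (by rw [add_sub_cancel_left]; exact hx'))
    (ny _ (by rw [sub_sub_cancel_left, norm_neg]; exact hy'))
  have hm2 := hmax (x - a) (y + c) (nx _ (by rw [sub_sub_cancel_left, norm_neg]; exact hx'))
    (ny _ (by rw [add_sub_cancel_left]; exact hy'))
  have b1 : ‖a + c‖ ^ 2 / δ ≤ 4900 * δ * (δ ^ 3) ^ 2 := by
    rw [ead, ecf, ← smul_add, norm_smul, Real.norm_eq_abs, abs_of_pos hε, div_le_iff₀ hδ]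
    have : ‖d + f‖ ^ 2 ≤ (70 * δ) ^ 2 := by gcongr
    calc (δ ^ 3 * ‖d + f‖) ^ 2 = (δ ^ 3) ^ 2 * ‖d + f‖ ^ 2 := by ring
      _ ≤ (δ ^ 3) ^ 2 * (70 * δ) ^ 2 := by gcongr
      _ = _ := by ring
  have b2 : 2 * δ * ‖a‖ ^ 2 ≤ 2 * δ * (δ ^ 3) ^ 2 := by gcongr
  have b3 : 7812 * δ * (δ ^ 3) ^ 2 ≤ δ / l * t ^ 2 := by
    calc 7812 * δ * (δ ^ 3) ^ 2 = δ * (δ ^ 3) ^ 2 * 7812 := by ring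
      _ ≤ δ * (δ ^ 3) ^ 2 * (θ ^ 2 / 64 / l) := by
        gcongr; rw [le_div_iff₀ hl0]; linarith
      _ = δ / l * (δ ^ 3 * (θ / 8)) ^ 2 := by ring
      _ ≤ _ := by gcongr
  have b4 : 0 < δ * (δ ^ 3) ^ 2 := by positivity
  linarith

theorem inner_gt_of_flat_discrete [ProperSpace E] {U V : E → ℝ} {e b : E} {l δ θ : ℝ} (hθ : 0 < θ)
    (hθ2 : θ ≤ 2) (hl : l = θ ^ 3 / 10 ^ 6) (hδ : 0 < δ) (hδl : δ ≤ l) (he : ‖e‖ = 1)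
    (hb : ‖b‖ = 1) (hU : DiscreteSub (δ ^ 3) U) (hV : DiscreteSub (δ ^ 3) (fun x => -V x))
    (hUc : Continuous U) (hVc : Continuous V) (hUV : ∀ x y, U x - V y ≤ ‖x - y‖ + 2 * δ ^ 3)
    (hflat : ∀ x, ‖x‖ ≤ 1 → 0 ≤ U x - ⟪e, x⟫ + l ∧ U x - ⟪e, x⟫ + l ≤ 3 * l)
    (htest : ∀ x, ‖x‖ ≤ 2 * δ → ⟪b, x⟫ - 4 * l * δ ≤ U x - V 0) : 1 - θ < ⟪b, e⟫ := by
  by_contra! hβ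
  have hl0 : 0 < l := by rw [hl]; positivity
  have hθs : θ ^ 2 ≤ 2 * θ := by nlinarith
  have hlθ : l ≤ θ ^ 2 / 500000 := by rw [hl]; nlinarith [sq_nonneg θ]
  have hδ1 : δ ≤ 1 / 125000 := by linarith
  have hδ2 : δ ^ 2 ≤ l / 125000 := by nlinarith
  set k := θ ^ 2 / 128 with hk
  have hk0 : 0 < k := by positivity
  have hk1 : k ≤ 1 / 32 := by linarith
  have hc : Continuous fun q : E × E => doubling U V e k l δ q.1 q.2 := by
    unfold doubling; fun_prop
  obtain ⟨⟨x, y⟩, hxy, hmax⟩ :=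
    ((isCompact_closedBall (0 : E) 1).prod (isCompact_closedBall (0 : E) 2)).exists_isMaxOn
      ⟨(0, 0), by simp⟩ hc.continuousOn
  have hx1 : ‖x‖ ≤ 1 := by simpa using hxy.1
  have hmax' : ∀ x' y', ‖x'‖ ≤ 1 → ‖y'‖ ≤ 2 →
      doubling U V e k l δ x' y' ≤ doubling U V e k l δ x y := fun x' y' h1 h2 =>
    hmax (a := (x', y')) ⟨by simpa using h1, by simpa using h2⟩
  obtain ⟨hs0, hs1⟩ := hflat x hx1
  set P := δ⁻¹ • (x - y) + k • e with hPdef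
  have hP : x - y + (k * δ) • e = δ • P := by
    rw [hPdef, smul_add, smul_smul, smul_smul, mul_inv_cancel₀ hδ.ne', one_smul, mul_comm]
  have hxyg : ‖x - y‖ = δ * ‖δ⁻¹ • (x - y)‖ := by
    rw [norm_smul, norm_inv, Real.norm_eq_abs, abs_of_pos hδ]; field_simp
  have hest : 1 / 2 - k * ⟪b, e⟫ - 14 * l ≤ ‖δ⁻¹ • (x - y)‖ - ‖P‖ ^ 2 / 2 - ‖x‖ ^ 2 := by
    set v := δ • (b - k • e) with hv
    have hvn : ‖v‖ ≤ 2 * δ := by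
      rw [hv, norm_smul, Real.norm_eq_abs, abs_of_pos hδ]
      have := norm_sub_le b (k • e)
      rw [norm_smul, he, hb, Real.norm_eq_abs, abs_of_pos hk0] at this
      nlinarith
    have h1 := htest v hvn
    have h2 := hmax' v 0 (by linarith) (by simp)
    have h3 : v - 0 + (k * δ) • e = δ • b := by rw [hv]; module
    have h4 : ⟪b, v⟫ = δ * (1 - k * ⟪b, e⟫) := by
      rw [hv, inner_smul_right, inner_sub_right, inner_smul_right, real_inner_self_eq_norm_sq, hb]
      ring
    unfold doubling at h2
    rw [h3, hP, norm_smul δ b, norm_smul δ P, hb, Real.norm_eq_abs, abs_of_pos hδ] at h2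
    have h5 : 0 ≤ δ / l * (U v - ⟪e, v⟫ + l) ^ 2 := by positivity
    have h6 : δ / l * (U x - ⟪e, x⟫ + l) ^ 2 ≤ 9 * l * δ := by
      calc _ ≤ δ / l * (3 * l) ^ 2 := by gcongr
        _ = 9 * l * δ := by field_simp; ring
    have h7 := hUV x y
    have h8 : δ * ‖v‖ ^ 2 ≤ δ * (2 * δ) ^ 2 := by gcongr
    have e1 : (δ * 1) ^ 2 / (2 * δ) = δ * (1 / 2) := by field_simp
    have e2 : (δ * ‖P‖) ^ 2 / (2 * δ) = δ * (‖P‖ ^ 2 / 2) := by field_simp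
    rw [e1, e2] at h2
    rw [h4] at h1
    rw [hxyg] at h7
    have h9 : δ * δ ^ 2 ≤ δ * (l / 125000) := by gcongr
    refine le_of_mul_le_mul_left ?_ hδ
    have h10 : 0 < l * δ := by positivity
    nlinarith
  obtain ⟨hx, hP1, hPe⟩ := slope_estimates hθ hθ2 hk hl he hPdef hβ hest
  refine not_interior_max hθ hθ2 hl hδ hδl he hU hV hP hx ?_ hs0 hs1 hP1 hPe hmax'
  have h1 : y = x - δ • P + (k * δ) • e := by rw [← hP]; abel
  rw [h1]
  refine (norm_add_le _ _).trans ?_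
  have h2 := norm_sub_le x (δ • P)
  rw [norm_smul, Real.norm_eq_abs, abs_of_pos hδ] at h2
  rw [norm_smul, he, Real.norm_eq_abs, abs_of_pos (by positivity)]
  have := (abs_le.1 hP1).2
  nlinarith

theorem inner_gt_of_flat [ProperSpace E] {u : E → ℝ} {e b : E} {l δ θ : ℝ} (hθ : 0 < θ)
    (hθ2 : θ ≤ 2) (hl : l = θ ^ 3 / 10 ^ 6) (hδ : 0 < δ) (hδl : δ ≤ l) (he : ‖e‖ = 1)
    (hb : ‖b‖ = 1) (hu : BallConeBound u) (hu' : BallConeBound (fun x => -u x))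
    (hL : ∀ x y, u x - u y ≤ ‖x - y‖)
    (hflat : ∀ x, ‖x‖ ≤ 1 → |u x - ⟪e, x⟫| ≤ l)
    (hflat' : ∀ x, ‖x‖ ≤ 2 * δ → |u x - ⟪b, x⟫| ≤ l * (2 * δ)) : 1 - θ < ⟪b, e⟫ := by
  have hε : 0 < δ ^ 3 := by positivity
  have hδ1 : δ ≤ 1 := by
    have : θ ^ 3 ≤ 2 ^ 3 := by gcongr
    linarith
  have hεl : δ ^ 3 ≤ l := le_trans (pow_le_of_le_one hδ.le hδ1 (by norm_num)) hδl
  obtain ⟨U, hUc, hU1, hU2, hU⟩ := exists_discreteSub hu hL hε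
  obtain ⟨W, hWc, hW1, hW2, hW⟩ := exists_discreteSub hu'
    (fun x y => by rw [norm_sub_rev]; linarith [hL y x]) hε
  refine inner_gt_of_flat_discrete (U := U) (V := fun x => -W x) hθ hθ2 hl hδ hδl he hb hU
    (by simpa using hW) hUc hWc.neg (fun x y => ?_) (fun x hx => ?_) (fun x hx => ?_)
  · linarith [hL x y, hU2 x, hW2 y]
  · have := abs_le.1 (hflat x hx)
    constructor <;> linarith [hU1 x, hU2 x]
  · have h1 := abs_le.1 (hflat' x hx)
    have h2 := abs_le.1 (hflat' 0 (by simpa using hδ.le))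
    rw [inner_zero_right] at h2
    linarith [hU1 x, hW1 0]

theorem BallConeBound.rescale {u : E → ℝ} (hu : BallConeBound u) {c R : ℝ} (hc : 0 ≤ c)
    (hR : 0 < R) (m : ℝ) : BallConeBound fun x => c * (u (R • x) - m) := by
  intro x r hr
  obtain ⟨z, hz, hxz, h⟩ := hu (R • x) (R * r) (by positivity)
  have hn : ∀ y, ‖R • y - R • x‖ = R * ‖y - x‖ := fun y => by
    rw [← smul_sub, norm_smul, Real.norm_eq_abs, abs_of_pos hR]
  have hRz : R • R⁻¹ • z = z := by rw [smul_smul, mul_inv_cancel₀ hR.ne', one_smul]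
  refine ⟨R⁻¹ • z, ?_, ?_, fun y hy => ?_⟩
  · rw [← hRz, hn] at hz; exact le_of_mul_le_mul_left hz hR
  · simp only [hRz]; gcongr
  · simp only [hRz]
    have h1 := h (R • y) (by rw [hn]; gcongr)
    rw [hn, mul_div_mul_left _ _ hR.ne'] at h1
    nlinarith [mul_le_mul_of_nonneg_left h1 hc]

theorem exists_growth {F : Type*} [NormedAddCommGroup F] {u : F → ℝ} (hu : BallConeBound u) (hL : ∀ x y, u x - u y ≤ ‖x - y‖)
    (hs : ∀ c < 1, ∃ x y, x ≠ y ∧ c * ‖x - y‖ < u y - u x) {η : ℝ} (hη : 0 < η) :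
    ∃ R₀ : ℝ, 0 < R₀ ∧ ∀ R ≥ R₀, ∃ p, ‖p‖ ≤ R ∧ (1 - η) * R ≤ u p - u 0 := by
  obtain ⟨x, y, hxy, h⟩ := hs (1 - η / 2) (by linarith)
  have hr : 0 < ‖y - x‖ := norm_pos_iff.2 (sub_ne_zero.2 hxy.symm)
  refine ⟨‖y - x‖ + ‖x‖ + 4 * ‖x‖ / η, by positivity, fun R hR => ?_⟩
  have hx0 : 0 ≤ 4 * ‖x‖ / η := by positivity
  have hRx : ‖y - x‖ ≤ R - ‖x‖ := by linarith
  have hRη : 4 * ‖x‖ ≤ R * η := by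
    rw [← div_le_iff₀ hη]; linarith [norm_nonneg x]
  obtain ⟨z, hz, -, hcone⟩ := hu x (R - ‖x‖) (by linarith)
  refine ⟨z, ?_, ?_⟩
  · have := norm_add_le (z - x) x
    rw [sub_add_cancel] at this; linarith
  · have h1 := hcone y hRx
    have h2 : (1 - η / 2) * ‖y - x‖ < (u z - u x) * (‖y - x‖ / (R - ‖x‖)) := by
      rw [norm_sub_rev]; rw [norm_sub_rev] at h1; linarith
    have h3 : (1 - η / 2) * (R - ‖x‖) < u z - u x := by
      rw [mul_div_assoc', lt_div_iff₀ (by linarith)] at h2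
      refine lt_of_mul_lt_mul_right ?_ hr.le
      linarith
    have h4 := hL 0 x
    rw [zero_sub, norm_neg] at h4
    nlinarith [norm_nonneg x]

theorem norm_sub_le_of_normalize {x p : E} (hp : p ≠ 0) :
    ‖x - p‖ ≤ ‖p‖ - ⟪‖p‖⁻¹ • p, x⟫ + ‖x‖ ^ 2 / (2 * ‖p‖) := by
  have hp' : 0 < ‖p‖ := norm_pos_iff.2 hp
  have h1 := norm_sub_sq_real x p
  have h2 : ‖x - p‖ ≤ (‖p‖ ^ 2 + ‖x - p‖ ^ 2) / (2 * ‖p‖) := by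
    rw [le_div_iff₀ (by positivity)]; nlinarith [sq_nonneg (‖p‖ - ‖x - p‖)]
  refine h2.trans_eq ?_
  rw [h1, inner_smul_left, real_inner_comm]
  simp only [conj_trivial]
  field_simp; ring

theorem lower_plane_of_growth {u : E → ℝ} (hL : ∀ x y, u x - u y ≤ ‖x - y‖) {τ R : ℝ}
    (hτ : 0 < τ) (hτ2 : τ ≤ 1 / 2) (hR : 0 < R) {p : E} (hp : ‖p‖ ≤ R / τ)
    (hup : (1 - τ ^ 2) * (R / τ) ≤ u p - u 0) :
    p ≠ 0 ∧ ∀ x, ‖x‖ ≤ R → ⟪‖p‖⁻¹ • p, x⟫ - 2 * τ * R ≤ u x - u 0 := by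
  have hRτ : 0 < R / τ := by positivity
  have hpl : R / τ / 2 ≤ ‖p‖ := by
    have := hL p 0
    rw [sub_zero] at this
    have h1 : 1 / 2 ≤ 1 - τ ^ 2 := by nlinarith
    linarith [mul_le_mul_of_nonneg_right h1 hRτ.le]
  have hp0 : p ≠ 0 := norm_pos_iff.1 (by linarith)
  refine ⟨hp0, fun x hx => ?_⟩
  have h1 := norm_sub_le_of_normalize (x := x) hp0
  have h2 := hL p x
  rw [norm_sub_rev] at h2
  have h3 : ‖x‖ ^ 2 / (2 * ‖p‖) ≤ τ * R := by
    rw [div_le_iff₀ (by linarith)]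
    have h5 : ‖x‖ ^ 2 ≤ R ^ 2 := by gcongr
    have h4 : τ * R * (2 * (R / τ / 2)) ≤ τ * R * (2 * ‖p‖) := by gcongr
    have h6 : τ * R * (2 * (R / τ / 2)) = R ^ 2 := by field_simp
    linarith
  have h4 : (1 - τ ^ 2) * (R / τ) = R / τ - τ * R := by field_simp
  linarith

theorem exists_flat {u : E → ℝ} (hu : BallConeBound u) (hu' : BallConeBound (fun x => -u x))
    (hL : ∀ x y, u x - u y ≤ ‖x - y‖) (hs : ∀ c < 1, ∃ x y, x ≠ y ∧ c * ‖x - y‖ < u y - u x)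
    {l : ℝ} (hl : 0 < l) (hl1 : l ≤ 1) :
    ∃ R₀ : ℝ, 0 < R₀ ∧ ∀ R ≥ R₀, ∃ e : E, ‖e‖ = 1 ∧
      ∀ x, ‖x‖ ≤ R → |u x - u 0 - ⟪e, x⟫| ≤ l * R := by
  have hτ : 0 < l / 6 := by linarith
  have hL' : ∀ x y, -u x - -u y ≤ ‖x - y‖ := fun x y => by
    rw [norm_sub_rev]; linarith [hL y x]
  obtain ⟨R₁, hR₁, h₁⟩ := exists_growth hu hL hs (pow_pos hτ 2)
  obtain ⟨R₂, hR₂, h₂⟩ := exists_growth hu' hL' (fun c hc => by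
    obtain ⟨x, y, hxy, h⟩ := hs c hc
    exact ⟨y, x, hxy.symm, by rw [norm_sub_rev]; linarith⟩) (pow_pos hτ 2)
  refine ⟨R₁ + R₂, by linarith, fun R hR => ?_⟩
  have hR0 : 0 < R := by linarith
  have hRR : R ≤ R / (l / 6) := by rw [le_div_iff₀ hτ]; nlinarith
  obtain ⟨p, hp, hup⟩ := h₁ (R / (l / 6)) (by linarith)
  obtain ⟨q, hq, huq⟩ := h₂ (R / (l / 6)) (by linarith)
  obtain ⟨hp0, hpl⟩ := lower_plane_of_growth hL hτ (by linarith) hR0 hp hup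
  obtain ⟨-, hql⟩ := lower_plane_of_growth hL' hτ (by linarith) hR0 hq huq
  refine ⟨‖p‖⁻¹ • p, ?_, fun x hx => ?_⟩
  · rw [norm_smul, norm_inv, norm_norm, inv_mul_cancel₀ (norm_ne_zero_iff.2 hp0)]
  · have e1 := hpl x hx
    have e2 := hql x hx
    have e3 := hpl (-x) (by rwa [norm_neg])
    have e4 := hql (-x) (by rwa [norm_neg])
    rw [inner_neg_right] at e3 e4
    rw [abs_le]
    constructor <;> nlinarith

/-- Directions of approximate flatness at two very different scales nearly agree. -/
theorem inner_gt_of_flat_scales [ProperSpace E] {u : E → ℝ} (hu : BallConeBound u)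
    (hu' : BallConeBound (fun x => -u x)) (hL : ∀ x y, u x - u y ≤ ‖x - y‖)
    {l θ r R : ℝ} {e b : E} (hθ : 0 < θ) (hθ2 : θ ≤ 2) (hl : l = θ ^ 3 / 10 ^ 6) (hr : 0 < r)
    (hrR : r ≤ 2 * l * R) (he : ‖e‖ = 1) (hb : ‖b‖ = 1)
    (hflat : ∀ x, ‖x‖ ≤ R → |u x - u 0 - ⟪e, x⟫| ≤ l * R)
    (hflat' : ∀ x, ‖x‖ ≤ r → |u x - u 0 - ⟪b, x⟫| ≤ l * r) : 1 - θ < ⟪b, e⟫ := by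
  have hl0 : 0 < l := by rw [hl]; positivity
  have hR : 0 < R := by
    by_contra! h
    nlinarith
  have hn : ∀ x : E, ‖R • x‖ = R * ‖x‖ := fun x => by
    rw [norm_smul, Real.norm_eq_abs, abs_of_pos hR]
  have hscale : ∀ (v x : E) (t : ℝ), |u (R • x) - u 0 - ⟪v, R • x⟫| ≤ t →
      |R⁻¹ * (u (R • x) - u 0) - ⟪v, x⟫| ≤ R⁻¹ * t := fun v x t h => by
    have : R⁻¹ * (u (R • x) - u 0) - ⟪v, x⟫ = R⁻¹ * (u (R • x) - u 0 - ⟪v, R • x⟫) := by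
      rw [inner_smul_right]; field_simp
    rw [this, abs_mul, abs_of_pos (inv_pos.2 hR)]
    gcongr
  refine inner_gt_of_flat (u := fun x => R⁻¹ * (u (R • x) - u 0)) (δ := r / (2 * R)) hθ hθ2 hl
    (by positivity) (by rw [div_le_iff₀ (by positivity)]; linarith) he hb
    (hu.rescale (inv_nonneg.2 hR.le) hR _) ?_ (fun x y => ?_) (fun x hx => ?_) (fun x hx => ?_)
  · have := hu'.rescale (inv_nonneg.2 hR.le) hR (-u 0)
    convert this using 2
    ring
  · have := hL (R • x) (R • y)
    rw [← smul_sub, hn] at this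
    rw [← mul_sub, inv_mul_le_iff₀ hR]
    linarith
  · refine (hscale e x _ (hflat _ ?_)).trans_eq ?_
    · rw [hn]; nlinarith
    · field_simp
  · refine (hscale b x _ (hflat' _ ?_)).trans_eq ?_
    · rw [hn]
      calc R * ‖x‖ ≤ R * (2 * (r / (2 * R))) := by gcongr
        _ = r := by field_simp
    · field_simp

theorem exists_linear_asymptotics [ProperSpace E] {u : E → ℝ} (hu : BallConeBound u)
    (hu' : BallConeBound (fun x => -u x)) (hL : ∀ x y, u x - u y ≤ ‖x - y‖)
    (hs : ∀ c < 1, ∃ x y, x ≠ y ∧ c * ‖x - y‖ < u y - u x) :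
    ∃ a : E, ‖a‖ = 1 ∧ ∀ ε > 0, ∃ R₀ : ℝ, ∀ x, R₀ ≤ ‖x‖ → |u x - u 0 - ⟪a, x⟫| ≤ ε * ‖x‖ := by
  have hj : ∀ j : ℕ, ∃ (R : ℝ) (e : E), (j : ℝ) ≤ R ∧ ‖e‖ = 1 ∧
      ∀ x, ‖x‖ ≤ R → |u x - u 0 - ⟪e, x⟫| ≤ (1 / ((j : ℝ) + 1)) * R := by
    intro j
    obtain ⟨R₀, hR₀, h⟩ := exists_flat hu hu' hL hs (l := 1 / ((j : ℝ) + 1)) (by positivity)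
      (by rw [div_le_one (by positivity)]; linarith [Nat.cast_nonneg (α := ℝ) j])
    obtain ⟨e, he⟩ := h (max R₀ j) (le_max_left _ _)
    exact ⟨_, e, le_max_right _ _, he⟩
  choose R e hR he hflat using hj
  obtain ⟨a, ha, φ, hφ, hlim⟩ := (isCompact_sphere (0 : E) 1).tendsto_subseq
    (x := e) (fun j => by simpa using he j)
  have ha1 : ‖a‖ = 1 := by simpa using ha
  refine ⟨a, ha1, fun ε hε => ?_⟩
  obtain ⟨ε', hε', hε'1, hε'ε⟩ : ∃ ε' : ℝ, 0 < ε' ∧ ε' ≤ 1 ∧ ε' ≤ ε :=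
    ⟨min ε 1, lt_min hε one_pos, min_le_right _ _, min_le_left _ _⟩
  obtain ⟨θ, hθ⟩ : ∃ θ, θ = ε' ^ 2 / 8 := ⟨_, rfl⟩
  obtain ⟨l, hl⟩ : ∃ l, l = θ ^ 3 / 10 ^ 6 := ⟨_, rfl⟩
  have hθ0 : 0 < θ := by rw [hθ]; positivity
  have hθ1 : θ ≤ ε' / 8 := by rw [hθ]; nlinarith
  have hl0 : 0 < l := by rw [hl]; positivity
  have hlθ : l ≤ θ := by
    have := pow_le_of_le_one hθ0.le (by linarith) (n := 3) (by norm_num)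
    linarith
  obtain ⟨R₀, hR₀, hb⟩ := exists_flat hu hu' hL hs hl0 (by linarith)
  refine ⟨R₀, fun x hx => ?_⟩
  have hx0 : 0 < ‖x‖ := by linarith
  obtain ⟨b, hb1, hbflat⟩ := hb ‖x‖ hx
  have hba : 1 - θ ≤ ⟪b, a⟫ := by
    refine ge_of_tendsto (tendsto_const_nhds.inner hlim) ?_
    obtain ⟨N, hN⟩ := exists_nat_ge (max (1 / l) (‖x‖ / (2 * l)))
    filter_upwards [eventually_ge_atTop N] with i hi
    have hiN : (N : ℝ) ≤ φ i := by exact_mod_cast hi.trans (hφ.id_le i)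
    have h1 : 1 / l ≤ φ i := (le_max_left _ _).trans (hN.trans hiN)
    have h2 : ‖x‖ / (2 * l) ≤ R (φ i) := (le_max_right _ _).trans (hN.trans (hiN.trans (hR _)))
    have hR0 : 0 ≤ R (φ i) := le_trans (by positivity) h2
    refine (inner_gt_of_flat_scales hu hu' hL hθ0 (by linarith) hl hx0 ?_ (he _) hb1
      (fun y hy => (hflat _ y hy).trans ?_) hbflat).le
    · rw [div_le_iff₀ (by positivity)] at h2; linarith
    · gcongr
      rw [div_le_iff₀ hl0] at h1
      rw [div_le_iff₀ (by positivity)]; linarith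
  have hab : ‖b - a‖ ≤ ε' / 2 := by
    refine abs_le_of_sq_le_sq' ?_ (by linarith) |>.2
    rw [norm_sub_sq_real, hb1, ha1]; linarith
  have h1 := hbflat x le_rfl
  have h2 := (abs_real_inner_le_norm (b - a) x).trans
    (mul_le_mul_of_nonneg_right hab (norm_nonneg x))
  have h3 : u x - u 0 - ⟪a, x⟫ = (u x - u 0 - ⟪b, x⟫) + ⟪b - a, x⟫ := by
    rw [inner_sub_left]; ring
  rw [h3]
  refine (abs_add_le _ _).trans ?_
  have h4 : (l + ε' / 2) * ‖x‖ ≤ ε * ‖x‖ := by gcongr; linarith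
  linarith

end Core

theorem CmpAbove.ballConeBound {n : ℕ} {u : Euc n → ℝ} (hc : Continuous u)
    (hu : CmpAbove univ u) : BallConeBound u := by
  intro x r hr
  obtain ⟨z, hz, hmax⟩ := (isCompact_closedBall x r).exists_isMaxOn
    ⟨x, mem_closedBall_self hr.le⟩ hc.continuousOn
  have hmax' : ∀ y, ‖y - x‖ ≤ r → u y ≤ u z := fun y hy =>
    hmax (by simpa [dist_eq_norm] using hy)
  refine ⟨z, by simpa [dist_eq_norm] using hz, hmax' x (by simpa using hr.le), fun y hy => ?_⟩
  rcases hy.lt_or_eq with hlt | heq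
  · have := hu (ball x r) isOpen_ball isBounded_ball (subset_univ _) x ((u z - u x) / r) (u x) ?_ y
      (by simpa [dist_eq_norm] using hlt)
    · calc u y - u x ≤ (u z - u x) / r * ‖y - x‖ := by linarith
        _ = _ := by ring
    · intro t ht
      by_cases htx : t = x
      · simp [htx]
      · have hts : ‖t - x‖ = r := by
          have h1 : t ∈ closedBall x r :=
            closure_ball_subset_closedBall (closure_mono sdiff_subset ht.1)
          rw [mem_closedBall, dist_eq_norm] at h1
          refine h1.eq_of_not_lt fun h2 => ht.2 ?_
          rw [(isOpen_ball.sdiff isClosed_singleton).interior_eq]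
          exact ⟨by simpa [dist_eq_norm] using h2, htx⟩
        rw [hts, div_mul_cancel₀ _ hr.ne']
        linarith [hmax' t hts.le]
  · rw [heq, div_self hr.ne', mul_one]
    linarith [hmax' y hy]

theorem CmpBelow.neg {n : ℕ} {Ω : Set (Euc n)} {u : Euc n → ℝ} (hu : CmpBelow Ω u) :
    CmpAbove Ω (fun x => -u x) := by
  intro V hV hb hcl x₀ a b h x hx
  have := hu V hV hb hcl x₀ (-a) (-b) (fun y hy => by linarith [h y hy]) x hx
  linarith

theorem lipOn_nonneg {n : ℕ} (u : Euc n → ℝ) (S : Set (Euc n)) : 0 ≤ lipOn u S := by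
  refine Real.sSup_nonneg ?_
  rintro _ ⟨p, -, rfl⟩
  positivity

theorem sub_le_lipOn_mul {n : ℕ} {u : Euc n → ℝ}
    (hLip : ∃ C : ℝ, ∀ x y : Euc n, |u x - u y| ≤ C * ‖x - y‖) (x y : Euc n) :
    u x - u y ≤ lipOn u univ * ‖x - y‖ := by
  obtain ⟨C, hC⟩ := hLip
  rcases eq_or_ne x y with rfl | hxy
  · simp
  have hpos : 0 < ‖x - y‖ := norm_pos_iff.2 (sub_ne_zero.2 hxy)
  rw [← div_le_iff₀ hpos]
  refine le_trans (div_le_div_of_nonneg_right (le_abs_self _) hpos.le) (le_csSup ⟨C, ?_⟩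
    ⟨(x, y), ⟨mem_univ _, mem_univ _, hxy⟩, rfl⟩)
  rintro _ ⟨p, hp, rfl⟩
  exact (div_le_iff₀ (norm_pos_iff.2 (sub_ne_zero.2 hp.2.2))).2 (hC _ _)

theorem exists_slope_gt_of_lt_lipOn {n : ℕ} {u : Euc n → ℝ} (hpos : 0 < lipOn u univ) {c : ℝ}
    (hc : c < lipOn u univ) : ∃ x y, x ≠ y ∧ c * ‖x - y‖ < u y - u x := by
  have hne : ((fun p : Euc n × Euc n => |u p.1 - u p.2| / ‖p.1 - p.2‖) ''
      {p : Euc n × Euc n | p.1 ∈ univ ∧ p.2 ∈ univ ∧ p.1 ≠ p.2}).Nonempty := by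
    by_contra! h
    rw [lipOn, h, Real.sSup_empty] at hpos
    exact hpos.false
  obtain ⟨_, ⟨⟨x, y⟩, ⟨-, -, hxy⟩, rfl⟩, h⟩ := exists_lt_of_lt_csSup hne hc
  rw [lt_div_iff₀ (norm_pos_iff.2 (sub_ne_zero.2 hxy))] at h
  rcases abs_cases (u x - u y) with ⟨h1, -⟩ | ⟨h1, -⟩ <;> simp only [h1] at h
  · exact ⟨y, x, hxy.symm, by rwa [norm_sub_rev]⟩
  · exact ⟨x, y, hxy, by linarith⟩

/-- Theorem 4, [MWZ16][HZ18]: an entire infinity harmonic function with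
Lip(w,ℝⁿ) < ∞ satisfies w(x) = a·x + o(|x|) for some a with |a| = Lip(w,ℝⁿ). -/
theorem stmt9 {n : ℕ} (w : Euc n → ℝ) (hw : Continuous w)
    (hIH : InfHarmonic (univ : Set (Euc n)) w)
    (hLip : ∃ C : ℝ, ∀ x y : Euc n, |w x - w y| ≤ C * ‖x - y‖) :
    ∃ a : Euc n, ‖a‖ = lipOn w univ ∧
      Tendsto (fun x => (w x - ⟪a, x⟫) / ‖x‖) (cobounded (Euc n)) (𝓝 0) := by
  have hLL := sub_le_lipOn_mul hLip
  obtain ⟨L, hL⟩ : ∃ L, L = lipOn w univ := ⟨_, rfl⟩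
  rw [← hL] at hLL
  obtain ⟨a, ha, hasymp⟩ : ∃ a : Euc n, ‖a‖ = L ∧
      ∀ ε > 0, ∃ R₀ : ℝ, ∀ x, R₀ ≤ ‖x‖ → |w x - w 0 - ⟪a, x⟫| ≤ ε * ‖x‖ := by
    rcases (hL ▸ lipOn_nonneg w univ : 0 ≤ L).eq_or_lt with h0 | hpos
    · refine ⟨0, by simpa using h0, fun ε hε => ⟨0, fun x _ => ?_⟩⟩
      have h1 := hLL x 0
      have h2 := hLL 0 x
      rw [← h0, zero_mul] at h1 h2
      rw [inner_zero_left, sub_zero, show w x - w 0 = 0 by linarith, abs_zero]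
      positivity
    have hwa := hIH.1.ballConeBound hw
    have hwb := hIH.2.neg.ballConeBound hw.neg
    obtain ⟨a, ha, h⟩ := exists_linear_asymptotics
      (u := fun x => L⁻¹ * (w ((1 : ℝ) • x) - 0))
      (hwa.rescale (inv_nonneg.2 hpos.le) one_pos 0)
      (by convert hwb.rescale (inv_nonneg.2 hpos.le) one_pos 0 using 2; simp)
      (fun x y => by
        rw [← mul_sub, inv_mul_le_iff₀ hpos]; simpa using hLL x y)
      (fun c hc => by
        obtain ⟨x, y, hxy, h⟩ := exists_slope_gt_of_lt_lipOn (u := w) (c := L * c) (hL ▸ hpos)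
          (by rw [← hL]; nlinarith)
        refine ⟨x, y, hxy, ?_⟩
        rw [← mul_sub, lt_inv_mul_iff₀ hpos]
        simpa [mul_assoc] using h)
    refine ⟨L • a, by rw [norm_smul, ha, Real.norm_eq_abs, abs_of_pos hpos, mul_one],
      fun ε hε => ?_⟩
    obtain ⟨R₀, hR₀⟩ := h (L⁻¹ * ε) (by positivity)
    refine ⟨R₀, fun x hx => ?_⟩
    have h1 := hR₀ x hx
    simp only [one_smul, sub_zero] at h1
    rw [real_inner_smul_left, show w x - w 0 - L * ⟪a, x⟫
      = L * (L⁻¹ * w x - L⁻¹ * w 0 - ⟪a, x⟫) by field_simp, abs_mul, abs_of_pos hpos]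
    calc _ ≤ L * (L⁻¹ * ε * ‖x‖) := by gcongr
      _ = ε * ‖x‖ := by field_simp
  refine ⟨a, ha.trans hL, ?_⟩
  rw [Metric.tendsto_nhds]
  intro ε hε
  obtain ⟨R₀, hR₀⟩ := hasymp (ε / 3) (by positivity)
  filter_upwards [tendsto_norm_cobounded_atTop.eventually_ge_atTop
    (max R₀ (max 1 (3 * |w 0| / ε)))] with x hx
  obtain ⟨hx1, hx2, hx3⟩ : R₀ ≤ ‖x‖ ∧ 1 ≤ ‖x‖ ∧ 3 * |w 0| / ε ≤ ‖x‖ := by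
    simpa [max_le_iff] using hx
  have hx0 : 0 < ‖x‖ := by linarith
  rw [dist_zero_right, norm_div, norm_norm, div_lt_iff₀ hx0, Real.norm_eq_abs]
  rw [div_le_iff₀ hε] at hx3
  have h1 := hR₀ x hx1
  have h2 := abs_add_le (w x - w 0 - ⟪a, x⟫) (w 0)
  rw [show w x - w 0 - ⟪a, x⟫ + w 0 = w x - ⟪a, x⟫ by ring] at h2
  nlinarith
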